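/- arXiv:1405.6059 — 2 statements merged into one kernel-verified Lean document; each statement's English description precedes it below -/
import Mathlib

section
/- Let F be a real quadratic number field with the two real embeddings v₁, v₂ : F → ℝ. Let ε ∈ ℤ_F^× be a totally positive unit with N_{F/ℚ}(ε) = 1 and v₁(ε) < v₂(ε). Let x ∈ F be totally positive with 1 ≤ v₂(x)/v₁(x) < v₂(ε)/v₁(ε), and let X > 0 satisfy N_{F/ℚ}(x) ≤ X. Then Tr_{F/ℚ}(x) ≤ Tr_{F/ℚ}(ε)·√X. -/
open NumberField

/-- The embeddings into `ℂ` of a number field of degree two with two distinct real embeddings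
`v₁, v₂` are exactly those induced by `v₁` and `v₂`. -/
lemma exists_univ_algHom_complex_eq_pair {F : Type*} [Field F] [NumberField F]
    (hdeg : Module.finrank ℚ F = 2) {v₁ v₂ : F →+* ℝ} (hne : v₁ ≠ v₂) :
    ∃ σ τ : F →ₐ[ℚ] ℂ, σ ≠ τ ∧ (∀ y, σ y = v₁ y) ∧ (∀ y, τ y = v₂ y) ∧
      ∀ ρ : F →ₐ[ℚ] ℂ, ρ = σ ∨ ρ = τ := by
  classical
  let σ : F →ₐ[ℚ] ℂ := (Complex.ofRealHom.comp v₁).toRatAlgHom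
  let τ : F →ₐ[ℚ] ℂ := (Complex.ofRealHom.comp v₂).toRatAlgHom
  have hστ : σ ≠ τ := fun h =>
    hne (RingHom.ext fun y => Complex.ofReal_injective (DFunLike.congr_fun h y))
  have huniv : ({σ, τ} : Finset (F →ₐ[ℚ] ℂ)) = Finset.univ := by
    rw [← Finset.card_eq_iff_eq_univ, Finset.card_pair hστ, AlgHom.card, hdeg]
  refine ⟨σ, τ, hστ, fun _ => rfl, fun _ => rfl, fun ρ => ?_⟩
  simpa [← huniv] using Finset.mem_univ ρ

lemma norm_eq_mul_of_real_embeddings {F : Type*} [Field F] [NumberField F]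
    (hdeg : Module.finrank ℚ F = 2) {v₁ v₂ : F →+* ℝ} (hne : v₁ ≠ v₂) (y : F) :
    (Algebra.norm ℚ y : ℝ) = v₁ y * v₂ y := by
  obtain ⟨σ, τ, hστ, hσ, hτ, hall⟩ := exists_univ_algHom_complex_eq_pair hdeg hne
  have h := Algebra.norm_eq_prod_embeddings ℚ ℂ y
  rw [Fintype.prod_eq_mul σ τ hστ fun ρ hρ => absurd (hall ρ) (by tauto), hσ, hτ,
    eq_ratCast] at h
  exact_mod_cast h

lemma trace_eq_add_of_real_embeddings {F : Type*} [Field F] [NumberField F]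
    (hdeg : Module.finrank ℚ F = 2) {v₁ v₂ : F →+* ℝ} (hne : v₁ ≠ v₂) (y : F) :
    (Algebra.trace ℚ F y : ℝ) = v₁ y + v₂ y := by
  obtain ⟨σ, τ, hστ, hσ, hτ, hall⟩ := exists_univ_algHom_complex_eq_pair hdeg hne
  have h := trace_eq_sum_embeddings ℂ (K := ℚ) (x := y)
  rw [Fintype.sum_eq_add σ τ hστ fun ρ hρ => absurd (hall ρ) (by tauto), hσ, hτ,
    eq_ratCast] at h
  exact_mod_cast h

lemma add_le_add_mul_sqrt_of_div_le_div {a b e f X : ℝ} (ha : 0 < a) (he : 0 < e)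
    (hef : e * f = 1) (hlt : e ≤ f) (hlo : 1 ≤ b / a) (hhi : b / a ≤ f / e)
    (hX : a * b ≤ X) : a + b ≤ (e + f) * √X := by
  rw [one_le_div ha] at hlo
  rw [div_le_div_iff₀ ha he] at hhi
  have hf : 0 < f := he.trans_le hlt
  have hfac : 0 ≤ (f * a - b * e) * (f * b - e * a) :=
    mul_nonneg (by linarith)
      (sub_nonneg.2 (mul_le_mul hlt hlo ha.le hf.le))
  have hexp : (f * a - b * e) * (f * b - e * a) =
      (e + f) ^ 2 * (a * b) - (a + b) ^ 2 * (e * f) := by ring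
  rw [hexp, hef, mul_one] at hfac
  have hX₀ : 0 ≤ X := (mul_nonneg ha.le (ha.le.trans hlo)).trans hX
  refine le_of_pow_le_pow_left₀ two_ne_zero (by positivity) ?_
  rw [mul_pow, Real.sq_sqrt hX₀]
  linarith [mul_le_mul_of_nonneg_left hX (sq_nonneg (e + f))]

/-- Lemma 3.4: let `F` be a real quadratic field with real embeddings `v₁, v₂`,
let `ε` be a totally positive unit of norm `1` with `v₁(ε) < v₂(ε)`, and let `x ∈ F`
be totally positive lying in the Shintani cone `1 ≤ v₂(x)/v₁(x) < v₂(ε)/v₁(ε)`.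
If `N(x) ≤ X` then `Tr(x) ≤ Tr(ε)·√X`. -/
theorem trace_le_of_norm_le_shintani (F : Type*) [Field F] [NumberField F]
    (hdeg : Module.finrank ℚ F = 2)
    (v₁ v₂ : F →+* ℝ) (hne : v₁ ≠ v₂)
    (hall : ∀ v : F →+* ℝ, v = v₁ ∨ v = v₂)
    (ε : (𝓞 F)ˣ)
    (hεpos₁ : 0 < v₁ ((ε : 𝓞 F) : F)) (hεpos₂ : 0 < v₂ ((ε : 𝓞 F) : F))
    (hεnorm : Algebra.norm ℚ ((ε : 𝓞 F) : F) = 1)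
    (hεlt : v₁ ((ε : 𝓞 F) : F) < v₂ ((ε : 𝓞 F) : F))
    (x : F) (hx₁ : 0 < v₁ x) (hx₂ : 0 < v₂ x)
    (hlo : 1 ≤ v₂ x / v₁ x)
    (hhi : v₂ x / v₁ x < v₂ ((ε : 𝓞 F) : F) / v₁ ((ε : 𝓞 F) : F))
    (X : ℝ) (hX : 0 < X)
    (hNx : (Algebra.norm ℚ x : ℝ) ≤ X) :
    (Algebra.trace ℚ F x : ℝ) ≤ (Algebra.trace ℚ F ((ε : 𝓞 F) : F) : ℝ) * Real.sqrt X := by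
  rw [norm_eq_mul_of_real_embeddings hdeg hne] at hNx
  have hε := norm_eq_mul_of_real_embeddings hdeg hne ((ε : 𝓞 F) : F)
  rw [hεnorm, Rat.cast_one] at hε
  rw [trace_eq_add_of_real_embeddings hdeg hne, trace_eq_add_of_real_embeddings hdeg hne]
  exact add_le_add_mul_sqrt_of_div_le_div hx₁ hεpos₁ hε.symm hεlt.le hlo hhi.le hNx
end

section
/- Let F be a totally real number field of degree n with real embeddings v₁,…,vₙ, let v : F → ℝⁿ be given by v(a) = (v₁(a),…,vₙ(a)), and let U = {v(u) : u ∈ ℤ_F^{×2}} act on ℝⁿ_{>0} by componentwise multiplication. Then there exist finitely many tuples (w₁,…,w_r) of linearly independent vectors lying in v(F) ∩ ℝⁿ_{≥0} such that the open simplicial cones C(w₁,…,w_r) = {λ₁w₁ + ⋯ + λ_r w_r : all λᵢ > 0} are pairwise disjoint, contained in ℝⁿ_{>0}, and their union Δ satisfies: ℝⁿ_{>0} is the disjoint union of the sets u·Δ over u ∈ U. -/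
open NumberField

namespace Shintani

section Polyhedral

variable {V : Type*} [AddCommGroup V] [Module ℝ V]

/-- The open cone spanned by a finite tuple of vectors. -/
def openCone {r : ℕ} (w : Fin r → V) : Set V :=
  {x | ∃ lam : Fin r → ℝ, (∀ i, 0 < lam i) ∧ x = ∑ i, lam i • w i}

/-- The sign cell of a family of linear forms. -/
def signCell {ι : Type*} (l : ι → V →ₗ[ℝ] ℝ) (σ : ι → SignType) : Set V :=
  {x | ∀ i, SignType.sign (l i x) = σ i}

/-- The set of points `t • p + y` with `t > 0` and `y ∈ S`. -/
def joinRay (p : V) (S : Set V) : Set V :=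
  {x | ∃ t : ℝ, 0 < t ∧ ∃ y ∈ S, x = t • p + y}

theorem sign_add_of_sign_eq {a b : ℝ}
    (h : SignType.sign b = 0 ∨ SignType.sign b = SignType.sign a) :
    SignType.sign (a + b) = SignType.sign a := by
  rcases h with h | h
  · rw [sign_eq_zero_iff.1 h, add_zero]
  · rcases lt_trichotomy a 0 with ha | rfl | ha
    · rw [sign_neg ha] at h ⊢
      exact sign_neg (add_neg ha (sign_eq_neg_one_iff.1 h))
    · rwa [zero_add]
    · rw [sign_pos ha] at h ⊢
      exact sign_pos (add_pos ha (sign_eq_one_iff.1 h))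

theorem signCell_add_mem {ι : Type*} (l : ι → V →ₗ[ℝ] ℝ) {σ τ : ι → SignType}
    (hτ : ∀ i, τ i = 0 ∨ τ i = σ i) {p y : V} (hp : p ∈ signCell l σ) (hy : y ∈ signCell l τ)
    {t : ℝ} (ht : 0 < t) : t • p + y ∈ signCell l σ := by
  intro i
  have h : SignType.sign (t * l i p) = σ i := by rw [sign_mul, sign_pos ht, one_mul, hp i]
  rw [map_add, map_smul, smul_eq_mul, sign_add_of_sign_eq, h]
  rw [hy i, h]
  exact hτ i

theorem signCell_eq_iUnion_joinRay {ι : Type*} [Fintype ι] (l : ι → V →ₗ[ℝ] ℝ)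
    {σ : ι → SignType} (hσ : σ ≠ 0) {p : V} (hp : p ∈ signCell l σ) :
    signCell l σ = ⋃ τ : {τ : ι → SignType // (∀ i, τ i = 0 ∨ τ i = σ i) ∧ τ ≠ σ},
      joinRay p (signCell l τ) := by
  classical
  ext x
  simp only [Set.mem_iUnion]
  constructor
  · intro hx
    have hne : (Finset.univ.filter fun i => σ i ≠ 0).Nonempty := by
      obtain ⟨i, hi⟩ := Function.ne_iff.1 hσ
      exact ⟨i, by simpa using hi⟩
    obtain ⟨i₀, hi₀, hmin⟩ := Finset.exists_min_image _ (fun i => l i x / l i p) hne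
    simp only [Finset.mem_filter, Finset.mem_univ, true_and] at hi₀ hmin
    have hlp : ∀ i, σ i ≠ 0 → l i p ≠ 0 := fun i hi h => hi (by rw [← hp i, h, sign_zero])
    have ht : 0 < l i₀ x / l i₀ p := by
      rw [← sign_eq_one_iff, div_eq_mul_inv, sign_mul, hx i₀]
      have h2 : SignType.sign (l i₀ p)⁻¹ = σ i₀ := by
        rcases lt_or_gt_of_ne (hlp i₀ hi₀) with h | h
        · rw [← hp i₀, sign_neg h, sign_neg (inv_lt_zero.2 h)]
        · rw [← hp i₀, sign_pos h, sign_pos (inv_pos.2 h)]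
      rw [h2]
      revert hi₀
      cases σ i₀ <;> decide
    set t := l i₀ x / l i₀ p with htdef
    have hy : ∀ i, σ i ≠ 0 → l i (x - t • p) = l i p * (l i x / l i p - t) := by
      intro i hi
      have := hlp i hi
      simp only [map_sub, map_smul, smul_eq_mul]
      field_simp
    refine ⟨⟨fun i => SignType.sign (l i (x - t • p)), fun i => ?_, fun h => ?_⟩, t, ht, x - t • p,
      fun i => rfl, by abel⟩
    · by_cases hi : σ i = 0
      · left
        have h1 : l i x = 0 := sign_eq_zero_iff.1 (by rw [hx i, hi])
        have h2 : l i p = 0 := sign_eq_zero_iff.1 (by rw [hp i, hi])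
        simp [h1, h2]
      · beta_reduce
        rw [hy i hi, sign_mul, hp i]
        rcases (sub_nonneg.2 (hmin i hi)).eq_or_lt with h | h
        · left; rw [← h, sign_zero, mul_zero]
        · right; rw [sign_pos h, mul_one]
    · have h1 := congrFun h i₀
      simp only [hy i₀ hi₀, ← htdef, sub_self, mul_zero, sign_zero] at h1
      exact hi₀ h1.symm
  · rintro ⟨⟨τ, hτ, _⟩, t, ht, y, hy, rfl⟩
    exact signCell_add_mem l hτ hp hy ht

theorem disjoint_joinRay_signCell {ι : Type*} (l : ι → V →ₗ[ℝ] ℝ)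
    {σ : ι → SignType} {p : V} (hp : p ∈ signCell l σ) {τ τ' : ι → SignType}
    (hτ : ∀ i, τ i = 0 ∨ τ i = σ i) (hτσ : τ ≠ σ) (hτ' : ∀ i, τ' i = 0 ∨ τ' i = σ i)
    (hτσ' : τ' ≠ σ) (hne : τ ≠ τ') :
    Disjoint (joinRay p (signCell l τ)) (joinRay p (signCell l τ')) := by
  have key : ∀ {τ τ' : ι → SignType}, (∀ i, τ' i = 0 ∨ τ' i = σ i) → τ ≠ σ →
      ∀ {t t' : ℝ} {y y' : V}, y ∈ signCell l τ → y' ∈ signCell l τ' →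
      t • p + y = t' • p + y' → t' ≤ t := by
    intro τ τ' hτ' hτσ t t' y y' hy hy' h
    by_contra hlt
    have hyeq : y = (t' - t) • p + y' := by
      rw [sub_smul, sub_add_eq_add_sub, ← h]; abel
    have hyσ : y ∈ signCell l σ := by
      rw [hyeq]; exact signCell_add_mem l hτ' hp hy' (sub_pos.2 (not_le.1 hlt))
    exact hτσ (funext fun i => (hy i).symm.trans (hyσ i))
  refine Set.disjoint_left.2 ?_
  rintro x ⟨t, -, y, hy, rfl⟩ ⟨t', -, y', hy', h⟩
  have ht : t = t' := le_antisymm (key hτ hτσ' hy' hy h.symm) (key hτ' hτσ hy hy' h)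
  subst ht
  have hyy := add_left_cancel h
  subst hyy
  exact hne (funext fun i => (hy i).symm.trans (hy' i))

variable [Module ℚ V]

/-- A linear form taking rational values on the rational structure `M`. -/
def IsRationalForm (M : Submodule ℚ V) (l : V →ₗ[ℝ] ℝ) : Prop :=
  ∀ x ∈ M, ∃ q : ℚ, l x = q

/-- An open simplicial cone with generators in `M`. -/
def IsSimplicialCone (M : Submodule ℚ V) (C : Set V) : Prop :=
  ∃ (r : ℕ) (w : Fin r → V), LinearIndependent ℝ w ∧ (∀ i, w i ∈ M) ∧ C = openCone w

/-- A finite disjoint union of open simplicial cones with generators in `M`. -/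
def Triangulable (M : Submodule ℚ V) (S : Set V) : Prop :=
  ∃ T : Set (Set V), T.Finite ∧ T.PairwiseDisjoint id ∧ (∀ C ∈ T, IsSimplicialCone M C) ∧
    ⋃₀ T = S

theorem exists_mem_sign_eq (M : Submodule ℚ V) (hM : Submodule.span ℝ (M : Set V) = ⊤)
    {ι : Type*} [Finite ι] (l : ι → V →ₗ[ℝ] ℝ) (hl : ∀ i, IsRationalForm M (l i)) (x : V) :
    ∃ p ∈ M, ∀ i, SignType.sign (l i p) = SignType.sign (l i x) := by
  classical
  have hx : x ∈ Submodule.span ℝ (M : Set V) := hM ▸ Submodule.mem_top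
  obtain ⟨k, r, m, rfl⟩ := Submodule.mem_span_set'.1 hx
  let b := Module.Basis.ofVectorSpace ℚ ℝ
  let S : Finset _ := Finset.univ.biUnion fun j => (b.repr (r j)).support
  let q : S → V := fun s => ∑ j, (b.repr (r j) s) • (m j : V)
  have hq : ∀ s, q s ∈ M := fun s => M.sum_mem fun j _ => M.smul_mem _ (m j).2
  have hxq : ∑ j, r j • (m j : V) = ∑ s : S, b s • q s := by
    have hr : ∀ j, r j = ∑ s : S, (b.repr (r j) s) • b s := by
      intro j
      conv_lhs => rw [← b.linearCombination_repr (r j), Finsupp.linearCombination_apply,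
        Finsupp.sum_of_support_subset (s := S) _
          (Finset.subset_biUnion_of_mem (fun j => (b.repr (r j)).support) (Finset.mem_univ j))
          _ (by simp)]
      rw [← Finset.sum_coe_sort]
    simp only [q, Finset.smul_sum]
    rw [Finset.sum_comm]
    refine Finset.sum_congr rfl fun j _ => ?_
    conv_lhs => rw [hr j, Finset.sum_smul]
    refine Finset.sum_congr rfl fun s _ => ?_
    rw [smul_assoc, smul_comm]
  choose ρ hρ using fun i s => hl i (q s) (hq s)
  have hval : ∀ (c : S → ℝ) i, l i (∑ s, c s • q s) = ∑ s, c s * ρ i s := by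
    intro c i
    simp [map_sum, hρ]
  have hlx : ∀ i, l i (∑ j, r j • (m j : V)) = ∑ s : S, b s * ρ i s := by
    intro i; rw [hxq, hval]
  have hzero : ∀ i, ∑ s : S, b s * (ρ i s : ℝ) = 0 → ∀ s, ρ i s = 0 := by
    intro i h
    have hli : LinearIndependent ℚ fun s : S => b s :=
      b.linearIndependent.comp _ Subtype.val_injective
    refine Fintype.linearIndependent_iff.1 hli (ρ i) ?_
    rw [← h]
    exact Finset.sum_congr rfl fun s _ => by rw [Rat.smul_def, mul_comm]
  let O : Set (S → ℝ) := {c | ∀ i, 0 < (∑ s, c s * ρ i s) * (∑ s : S, b s * ρ i s) ∨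
    ∑ s : S, b s * (ρ i s : ℝ) = 0}
  have hO : IsOpen O := by
    have : O = ⋂ i, {c : S → ℝ | 0 < (∑ s, c s * ρ i s) * (∑ s : S, b s * ρ i s) ∨
      ∑ s : S, b s * (ρ i s : ℝ) = 0} := by
      ext c; simp only [O, Set.mem_iInter]; rfl
    rw [this]
    refine isOpen_iInter_of_finite fun i => IsOpen.union ?_ isOpen_const
    have hcont : Continuous fun c : S → ℝ =>
      (∑ s, c s * (ρ i s : ℝ)) * ∑ s : S, b s * (ρ i s : ℝ) := by fun_prop
    exact isOpen_lt continuous_const hcont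
  have hbO : (fun s : S => b s) ∈ O := by
    intro i
    by_cases h : ∑ s : S, b s * (ρ i s : ℝ) = 0
    · exact Or.inr h
    · exact Or.inl (mul_self_pos.2 h)
  obtain ⟨_, hc, c, rfl⟩ := (DenseRange.piMap fun _ : S =>
    Rat.denseRange_cast (𝕜 := ℝ)).inter_open_nonempty _ hO ⟨_, hbO⟩
  refine ⟨∑ s, (c s : ℚ) • q s, M.sum_mem fun s _ => M.smul_mem _ (hq s), fun i => ?_⟩
  have hci : l i (∑ s, c s • q s) = ∑ s, (c s : ℝ) * ρ i s := by
    rw [← hval]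
    congr 1
    exact Finset.sum_congr rfl fun s _ => (algebraMap_smul ℝ (c s) (q s)).symm
  rw [hci, hlx]
  rcases hc i with h | h
  · simp only [Pi.map_apply] at h
    rcases mul_pos_iff.1 h with ⟨h1, h2⟩ | ⟨h1, h2⟩
    · rw [sign_pos h1, sign_pos h2]
    · rw [sign_neg h1, sign_neg h2]
  · rw [h]
    simp [hzero i h]

theorem triangulable_empty (M : Submodule ℚ V) : Triangulable M ∅ :=
  ⟨∅, Set.finite_empty, by simp, by simp, by simp⟩

theorem triangulable_singleton_zero (M : Submodule ℚ V) : Triangulable M {0} := by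
  refine ⟨{{0}}, Set.finite_singleton _, by simp, ?_, by simp⟩
  rintro _ rfl
  refine ⟨0, Fin.elim0, linearIndependent_empty_type, fun i => i.elim0, ?_⟩
  ext x
  simp [openCone]

theorem triangulable_iUnion (M : Submodule ℚ V) {ι : Type*} [Finite ι] {S : ι → Set V}
    (hS : ∀ i, Triangulable M (S i)) (hd : Pairwise fun i j => Disjoint (S i) (S j)) :
    Triangulable M (⋃ i, S i) := by
  choose T hf hp hc hu using hS
  refine ⟨⋃ i, T i, Set.finite_iUnion hf, ?_, ?_, ?_⟩
  · intro A hA B hB hAB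
    obtain ⟨i, hi⟩ := Set.mem_iUnion.1 hA
    obtain ⟨j, hj⟩ := Set.mem_iUnion.1 hB
    by_cases hij : i = j
    · subst hij
      exact hp i hi hj hAB
    · exact (hd hij).mono (hu i ▸ Set.subset_sUnion_of_mem hi) (hu j ▸ Set.subset_sUnion_of_mem hj)
  · intro C hC
    obtain ⟨i, hi⟩ := Set.mem_iUnion.1 hC
    exact hc i C hi
  · rw [Set.sUnion_iUnion]
    exact Set.iUnion_congr hu

theorem triangulable_joinRay (M : Submodule ℚ V) {p : V} (hp : p ∈ M) {S : Set V}
    (hS : Triangulable M S) (l : V →ₗ[ℝ] ℝ) (hl : ∀ x ∈ S, l x = 0) (hlp : l p ≠ 0) :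
    Triangulable M (joinRay p S) := by
  obtain ⟨T, hf, hd, hc, rfl⟩ := hS
  refine ⟨joinRay p '' T, hf.image _, ?_, ?_, ?_⟩
  · rintro _ ⟨A, hA, rfl⟩ _ ⟨B, hB, rfl⟩ hAB
    refine Set.disjoint_left.2 ?_
    rintro x ⟨t, -, y, hy, rfl⟩ ⟨t', -, y', hy', h⟩
    have h0 := congrArg l h
    simp only [map_add, map_smul, hl y ⟨A, hA, hy⟩, hl y' ⟨B, hB, hy'⟩, add_zero, smul_eq_mul] at h0
    have ht := mul_right_cancel₀ hlp h0
    subst ht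
    have hyy := add_left_cancel h
    subst hyy
    exact Set.disjoint_left.1 (hd hA hB fun h => hAB (by rw [h])) hy hy'
  · rintro _ ⟨C, hC, rfl⟩
    obtain ⟨r, w, hw, hwM, rfl⟩ := hc C hC
    have hlw : ∀ i, l (w i) = 0 := by
      intro i
      have h1 : ∑ j, (1 : ℝ) • w j ∈ ⋃₀ T := ⟨_, hC, fun _ => 1, by simp, rfl⟩
      have h2 : ∑ j, (1 + Pi.single (M := fun _ => ℝ) i 1 j) • w j ∈ ⋃₀ T := by
        refine ⟨_, hC, fun j => 1 + Pi.single (M := fun _ => ℝ) i 1 j, fun j => ?_, rfl⟩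
        have : (0 : ℝ) ≤ Pi.single (M := fun _ => ℝ) i 1 j := by
          rw [Pi.single_apply]; split_ifs <;> norm_num
        linarith
      have h3 := hl _ h2
      simp only [add_smul, Finset.sum_add_distrib, map_add, hl _ h1, zero_add] at h3
      simpa [Pi.single_apply] using h3
    refine ⟨r + 1, Fin.cons p w, linearIndependent_finCons.2 ⟨hw, fun hmem => hlp ?_⟩, ?_, ?_⟩
    · have : Submodule.span ℝ (Set.range w) ≤ LinearMap.ker l := by
        rw [Submodule.span_le]
        rintro _ ⟨i, rfl⟩
        exact hlw i
      exact this hmem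
    · intro i
      refine Fin.cases ?_ ?_ i
      · simpa using hp
      · simpa using hwM
    · ext x
      constructor
      · rintro ⟨t, ht, _, ⟨lam, hlam, rfl⟩, rfl⟩
        refine ⟨Fin.cons t lam, ?_, by simp [Fin.sum_univ_succ]⟩
        exact Fin.cases (by simpa using ht) (by simpa using hlam)
      · rintro ⟨lam, hlam, rfl⟩
        exact ⟨lam 0, hlam 0, _, ⟨fun i => lam i.succ, fun i => hlam _, rfl⟩,
          by simp [Fin.sum_univ_succ]⟩
  · ext x
    constructor
    · rintro ⟨_, ⟨C, hC, rfl⟩, t, ht, y, hy, rfl⟩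
      exact ⟨t, ht, y, ⟨C, hC, hy⟩, rfl⟩
    · rintro ⟨t, ht, y, ⟨C, hC, hy⟩, rfl⟩
      exact ⟨_, ⟨C, hC, rfl⟩, t, ht, y, hy, rfl⟩

theorem triangulable_signCell (M : Submodule ℚ V) (hM : Submodule.span ℝ (M : Set V) = ⊤)
    {ι : Type*} [Fintype ι] (l : ι → V →ₗ[ℝ] ℝ) (hl : ∀ i, IsRationalForm M (l i))
    (hsep : ∀ x, (∀ i, l i x = 0) → x = 0) (σ : ι → SignType) :
    Triangulable M (signCell l σ) := by
  classical
  induction hk : (Finset.univ.filter fun i => σ i ≠ 0).card using Nat.strong_induction_on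
    generalizing σ with
  | _ k ih =>
    subst hk
    rcases (signCell l σ).eq_empty_or_nonempty with he | ⟨x, hx⟩
    · rw [he]; exact triangulable_empty M
    by_cases hσ : σ = 0
    · have : signCell l σ = {0} := by
        ext y
        subst hσ
        simp only [signCell, Set.mem_ofPred_eq, Pi.zero_apply, sign_eq_zero_iff,
          Set.mem_singleton_iff]
        exact ⟨hsep y, fun h i => by rw [h, map_zero]⟩
      rw [this]; exact triangulable_singleton_zero M
    obtain ⟨p, hpM, hp⟩ := exists_mem_sign_eq M hM l hl x
    have hpσ : p ∈ signCell l σ := fun i => (hp i).trans (hx i)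
    rw [signCell_eq_iUnion_joinRay l hσ hpσ]
    refine triangulable_iUnion M ?_ ?_
    · rintro ⟨τ, hτ, hτσ⟩
      obtain ⟨i, hi⟩ := Function.ne_iff.1 hτσ
      have hi0 : τ i = 0 := (hτ i).resolve_right hi
      have hσi : σ i ≠ 0 := fun h => hi (hi0.trans h.symm)
      refine triangulable_joinRay M hpM (ih _ ?_ τ rfl) (l i) (fun y hy => ?_) (fun h => hσi ?_)
      · refine Finset.card_lt_card (Finset.ssubset_iff_of_subset ?_ |>.2 ⟨i, ?_, ?_⟩)
        · intro j
          simp only [Finset.mem_filter, Finset.mem_univ, true_and]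
          intro hj
          rwa [← (hτ j).resolve_left hj]
        · simpa using hσi
        · simpa using hi0
      · exact sign_eq_zero_iff.1 ((hy i).trans hi0)
      · rw [← hpσ i, h, sign_zero]
    · rintro ⟨τ, hτ, hτσ⟩ ⟨τ', hτ', hτσ'⟩ hne
      exact disjoint_joinRay_signCell l hpσ hτ hτσ hτ' hτσ' fun h => hne (Subtype.ext h)

/-- Membership in `S` is determined by the signs of finitely many rational linear forms. -/
def IsConstructible (M : Submodule ℚ V) (S : Set V) : Prop :=
  ∃ L : Set (V →ₗ[ℝ] ℝ), L.Finite ∧ (∀ l ∈ L, IsRationalForm M l) ∧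
    ∀ x y, (∀ l ∈ L, SignType.sign (l x) = SignType.sign (l y)) → x ∈ S → y ∈ S

theorem IsConstructible.triangulable {M : Submodule ℚ V}
    (hM : Submodule.span ℝ (M : Set V) = ⊤) (L₀ : Set (V →ₗ[ℝ] ℝ)) (hL₀ : L₀.Finite)
    (hrat : ∀ l ∈ L₀, IsRationalForm M l) (hsep : ∀ x, (∀ l ∈ L₀, l x = 0) → x = 0)
    {S : Set V} (hS : IsConstructible M S) : Triangulable M S := by
  classical
  obtain ⟨L, hL, hLrat, hLS⟩ := hS
  have : Fintype ↥(L ∪ L₀) := (hL.union hL₀).fintype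
  let l : ↥(L ∪ L₀) → V →ₗ[ℝ] ℝ := Subtype.val
  have hEq : S = ⋃ σ : {σ : ↥(L ∪ L₀) → SignType // signCell l σ ⊆ S}, signCell l σ := by
    ext x
    simp only [Set.mem_iUnion]
    constructor
    · intro hx
      exact ⟨⟨fun i => SignType.sign (l i x), fun y hy => hLS x y
        (fun f hf => (hy ⟨f, Or.inl hf⟩).symm) hx⟩, fun i => rfl⟩
    · rintro ⟨⟨σ, hσ⟩, hx⟩
      exact hσ hx
  rw [hEq]
  refine triangulable_iUnion M (fun σ => triangulable_signCell M hM l ?_ ?_ σ) ?_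
  · rintro ⟨f, hf | hf⟩
    · exact hLrat f hf
    · exact hrat f hf
  · exact fun x hx => hsep x fun f hf => hx ⟨f, Or.inr hf⟩
  · rintro ⟨σ, _⟩ ⟨σ', _⟩ hne
    refine Set.disjoint_left.2 fun x hx hx' => hne (Subtype.ext ?_)
    exact funext fun i => (hx i).symm.trans (hx' i)

theorem IsConstructible.compl {M : Submodule ℚ V} {S : Set V} (hS : IsConstructible M S) :
    IsConstructible M Sᶜ := by
  obtain ⟨L, hL, hr, h⟩ := hS
  exact ⟨L, hL, hr, fun x y hxy hx hy => hx (h y x (fun l hl => (hxy l hl).symm) hy)⟩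

theorem IsConstructible.iInter {M : Submodule ℚ V} {ι : Type*} [Finite ι] {S : ι → Set V}
    (hS : ∀ i, IsConstructible M (S i)) : IsConstructible M (⋂ i, S i) := by
  choose L hL hr h using hS
  refine ⟨⋃ i, L i, Set.finite_iUnion hL, fun l hl => ?_, fun x y hxy hx => ?_⟩
  · obtain ⟨i, hi⟩ := Set.mem_iUnion.1 hl
    exact hr i l hi
  · rw [Set.mem_iInter] at hx ⊢
    exact fun i => h i x y (fun l hl => hxy l (Set.mem_iUnion.2 ⟨i, hl⟩)) (hx i)

theorem IsConstructible.inter {M : Submodule ℚ V} {S T : Set V} (hS : IsConstructible M S)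
    (hT : IsConstructible M T) : IsConstructible M (S ∩ T) := by
  rw [Set.inter_eq_iInter]
  exact IsConstructible.iInter fun b => by cases b <;> assumption

theorem IsConstructible.union {M : Submodule ℚ V} {S T : Set V} (hS : IsConstructible M S)
    (hT : IsConstructible M T) : IsConstructible M (S ∪ T) := by
  rw [← compl_compl (S ∪ T), Set.compl_union]
  exact (hS.compl.inter hT.compl).compl

theorem IsConstructible.empty (M : Submodule ℚ V) : IsConstructible M (∅ : Set V) :=
  ⟨∅, Set.finite_empty, by simp, by simp⟩

theorem IsConstructible.preimage {M : Submodule ℚ V} {S : Set V} (hS : IsConstructible M S)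
    (f : V →ₗ[ℝ] V) (hf : ∀ x ∈ M, f x ∈ M) : IsConstructible M (f ⁻¹' S) := by
  obtain ⟨L, hL, hr, h⟩ := hS
  refine ⟨(fun l => l ∘ₗ f) '' L, hL.image _, ?_, fun x y hxy hx => ?_⟩
  · rintro _ ⟨l, hl, rfl⟩ x hx
    exact hr l hl _ (hf x hx)
  · exact h _ _ (fun l hl => hxy _ ⟨l, hl, rfl⟩) hx

theorem isConstructible_pos {M : Submodule ℚ V} {l : V →ₗ[ℝ] ℝ} (hl : IsRationalForm M l) :
    IsConstructible M {x | 0 < l x} := by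
  refine ⟨{l}, Set.finite_singleton _, by simpa using hl, fun x y hxy hx => ?_⟩
  have h := hxy l rfl
  rw [sign_pos hx] at h
  exact sign_eq_one_iff.1 h.symm

end Polyhedral

section Units

variable {F : Type*} [Field F] {n : ℕ} (v : Fin n → (F →+* ℝ))

/-- The vector of real embeddings of an element. -/
def embed (a : F) : Fin n → ℝ := fun t => v t a

/-- The set of vectors of real embeddings of squares of units. -/
def unitSquares : Set (Fin n → ℝ) :=
  {e | ∃ u : (𝓞 F)ˣ, e = fun t => v t (((u ^ 2 : (𝓞 F)ˣ) : 𝓞 F) : F)}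

theorem one_mem_unitSquares : (1 : Fin n → ℝ) ∈ unitSquares v :=
  ⟨1, by ext t; simp⟩

theorem mul_mem_unitSquares {e f : Fin n → ℝ} (he : e ∈ unitSquares v) (hf : f ∈ unitSquares v) :
    e * f ∈ unitSquares v := by
  obtain ⟨u, rfl⟩ := he
  obtain ⟨w, rfl⟩ := hf
  exact ⟨u * w, by ext t; simp [mul_pow]⟩

theorem inv_mem_unitSquares {e : Fin n → ℝ} (he : e ∈ unitSquares v) : e⁻¹ ∈ unitSquares v := by
  obtain ⟨u, rfl⟩ := he
  refine ⟨u⁻¹, ?_⟩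
  ext t
  have h : v t ((u : 𝓞 F) : F) * v t (((u⁻¹ : (𝓞 F)ˣ) : 𝓞 F) : F) = 1 := by
    rw [← map_mul, ← map_mul]
    simp
  simp only [Pi.inv_apply, Units.val_pow_eq_pow_val, map_pow]
  rw [← inv_pow, inv_eq_of_mul_eq_one_right h]

theorem embedding_unit_ne_zero (u : (𝓞 F)ˣ) (t : Fin n) : v t ((u : 𝓞 F) : F) ≠ 0 := by
  simp

theorem unitSquares_pos {e : Fin n → ℝ} (he : e ∈ unitSquares v) (t : Fin n) : 0 < e t := by
  obtain ⟨u, rfl⟩ := he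
  simp only [Units.val_pow_eq_pow_val, map_pow]
  have := embedding_unit_ne_zero v u t
  positivity

variable [NumberField F] (hn : n = Module.finrank ℚ F) (hv : Function.Bijective v)

include hn hv

theorem exists_complex_embedding_eq (φ : F →+* ℂ) :
    ∃ t, φ = Complex.ofRealHom.comp (v t) := by
  have hinj : Function.Injective fun t => Complex.ofRealHom.comp (v t) := by
    intro s t h
    refine hv.1 (RingHom.ext fun a => ?_)
    exact Complex.ofReal_injective (RingHom.congr_fun h a)
  have hcard : Fintype.card (Fin n) = Fintype.card (F →+* ℂ) := by
    rw [Embeddings.card, Fintype.card_fin, hn]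
  obtain ⟨t, ht⟩ := ((Fintype.bijective_iff_injective_and_card _).2 ⟨hinj, hcard⟩).2 φ
  exact ⟨t, ht.symm⟩

theorem bijective_mk_place :
    Function.Bijective fun t => InfinitePlace.mk (Complex.ofRealHom.comp (v t)) := by
  constructor
  · intro s t h
    refine hv.1 (RingHom.ext fun a => Complex.ofReal_injective ?_)
    rcases InfinitePlace.mk_eq_iff.1 h with h | h
    · exact RingHom.congr_fun h a
    · have := RingHom.congr_fun h a
      simpa using this
  · intro w
    obtain ⟨t, ht⟩ := exists_complex_embedding_eq v hn hv w.embedding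
    exact ⟨t, by beta_reduce; rw [← ht, w.mk_embedding]⟩

theorem mult_eq_one (w : InfinitePlace F) : w.mult = 1 := by
  obtain ⟨t, rfl⟩ := (bijective_mk_place v hn hv).2 w
  have : (InfinitePlace.mk (Complex.ofRealHom.comp (v t))).IsReal := by
    refine ⟨_, ?_, rfl⟩
    rw [ComplexEmbedding.isReal_iff]
    ext a
    simp
  simp [InfinitePlace.mult, this]

theorem sum_log_unit (u : (𝓞 F)ˣ) : ∑ t, Real.log |v t ((u : 𝓞 F) : F)| = 0 := by
  have h := Units.sum_mult_mul_log u
  rw [← (bijective_mk_place v hn hv).sum_comp] at h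
  simpa [mult_eq_one v hn hv] using h

theorem sum_log_unitSquares {e : Fin n → ℝ} (he : e ∈ unitSquares v) :
    ∑ t, Real.log (e t) = 0 := by
  obtain ⟨u, rfl⟩ := he
  have h := sum_log_unit v hn hv u
  simp only [Units.val_pow_eq_pow_val, map_pow, Real.log_pow, ← Finset.mul_sum]
  simp only [Real.log_abs] at h
  rw [h, mul_zero]

theorem finite_unitSquares_le (B : ℝ) : {e ∈ unitSquares v | ∀ t, e t ≤ B}.Finite := by
  refine ((Embeddings.finite_of_norm_le F ℂ B).image (embed v)).subset ?_
  rintro e ⟨he, hB⟩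
  have hpos := unitSquares_pos v he
  obtain ⟨u, rfl⟩ := he
  refine ⟨_, ⟨RingOfIntegers.isIntegral_coe _, fun φ => ?_⟩, rfl⟩
  obtain ⟨t, rfl⟩ := exists_complex_embedding_eq v hn hv φ
  have h : ‖(Complex.ofRealHom.comp (v t)) (((u ^ 2 : (𝓞 F)ˣ) : 𝓞 F) : F)‖ =
      |v t (((u ^ 2 : (𝓞 F)ˣ) : 𝓞 F) : F)| := Complex.norm_real _
  rw [h, abs_of_pos (hpos t)]
  exact hB t

theorem exists_unit_log_close :
    ∃ C : ℝ, ∀ y : Fin n → ℝ, ∑ t, y t = 0 →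
      ∃ u : (𝓞 F)ˣ, ∀ t, |y t - Real.log (|v t ((u : 𝓞 F) : F)|)| ≤ C := by
  classical
  let E := Equiv.ofBijective _ (bijective_mk_place v hn hv)
  have hE : ∀ t a, E t a = |v t a| := fun t a => by
    change ‖(Complex.ofRealHom.comp (v t)) a‖ = _
    exact Complex.norm_real _
  let b₀ := Module.Free.chooseBasis ℤ (Units.unitLattice F)
  let b := b₀.ofZLatticeBasis ℝ (Units.unitLattice F)
  let B := ∑ i, ‖b i‖
  have hB : 0 ≤ B := Finset.sum_nonneg fun i _ => norm_nonneg _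
  refine ⟨n * B + B, fun y hy => ?_⟩
  let z : Units.dirichletUnitTheorem.logSpace F := fun w => y (E.symm w.1)
  have hmem : (ZSpan.floor b z : Units.dirichletUnitTheorem.logSpace F) ∈ Units.unitLattice F :=
    (b₀.ofZLatticeBasis_span ℝ).le (ZSpan.floor b z).2
  have hfr := ZSpan.norm_fract_le b z
  rw [ZSpan.fract_apply] at hfr
  obtain ⟨u, -, hu⟩ := hmem
  have hu' : Units.logEmbedding F u = (ZSpan.floor b z : Units.dirichletUnitTheorem.logSpace F) :=
    hu
  rw [← hu'] at hfr
  refine ⟨u.toMul, ?_⟩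
  set d : Fin n → ℝ := fun t => y t - Real.log |v t ((u.toMul : 𝓞 F) : F)| with hd
  have hsum : ∑ t, d t = 0 := by
    simp only [hd, Finset.sum_sub_distrib, hy, sum_log_unit v hn hv, sub_zero]
  have hne : ∀ t, E t ≠ Units.dirichletUnitTheorem.w₀ → |d t| ≤ B := by
    intro t ht
    have h := (norm_le_pi_norm (z - Units.logEmbedding F u) ⟨E t, ht⟩).trans hfr
    have h2 : (z - Units.logEmbedding F u) ⟨E t, ht⟩ = d t := by
      rw [Pi.sub_apply, ← ofMul_toMul u, Units.dirichletUnitTheorem.logEmbedding_component,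
        mult_eq_one v hn hv]
      simp [z, hd, hE]
    rw [h2] at h
    exact h
  intro t
  by_cases ht : E t = Units.dirichletUnitTheorem.w₀
  · have h1 : d t = -∑ s ∈ Finset.univ.erase t, d s := by
      rw [← Finset.add_sum_erase _ _ (Finset.mem_univ t)] at hsum
      linarith
    change |d t| ≤ _
    rw [h1, abs_neg]
    have h2 : ∑ s ∈ Finset.univ.erase t, |d s| ≤ ∑ s ∈ Finset.univ.erase t, B := by
      refine Finset.sum_le_sum fun s hs => hne s fun h => ?_
      exact (Finset.mem_erase.1 hs).1 (E.injective (h.trans ht.symm))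
    have h3 : ∑ s ∈ Finset.univ.erase t, B ≤ n * B := by
      rw [Finset.sum_const, nsmul_eq_mul]
      refine mul_le_mul_of_nonneg_right ?_ hB
      exact_mod_cast (Finset.card_le_univ _).trans (Fintype.card_fin n).le
    linarith [Finset.abs_sum_le_sum_abs d (Finset.univ.erase t)]
  · have := hne t ht
    have hnB : 0 ≤ n * B := by positivity
    change |d t| ≤ _
    linarith

/-- The squares of units act on the positive orthant with bounded coordinate ratios on a set of
representatives. -/
theorem exists_unitSquares_ratio_le :
    ∃ R : ℝ, ∀ x : Fin n → ℝ, (∀ t, 0 < x t) → ∃ e ∈ unitSquares v, ∀ s t,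
      (e⁻¹ * x) s ≤ R * (e⁻¹ * x) t := by
  obtain ⟨C, hC⟩ := exists_unit_log_close v hn hv
  refine ⟨Real.exp (4 * C), fun x hx => ?_⟩
  have hn0 : (n : ℝ) ≠ 0 := by
    rw [hn]; exact_mod_cast Module.finrank_pos.ne'
  set A := (∑ t, Real.log (x t)) / n with hA
  obtain ⟨u, hu⟩ := hC (fun t => (Real.log (x t) - A) / 2) (by
    rw [← Finset.sum_div, Finset.sum_sub_distrib, Finset.sum_const, hA, Finset.card_univ,
      Fintype.card_fin, nsmul_eq_mul]
    field_simp
    simp)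
  refine ⟨_, ⟨u, rfl⟩, fun s t => ?_⟩
  have hpos := unitSquares_pos v ⟨u, rfl⟩
  have hlog : ∀ t, Real.log (v t (((u ^ 2 : (𝓞 F)ˣ) : 𝓞 F) : F)) =
      2 * Real.log |v t ((u : 𝓞 F) : F)| := by
    intro t
    simp [Real.log_abs]
  have hs := abs_le.1 (hu s)
  have ht := abs_le.1 (hu t)
  simp only [Pi.mul_apply, Pi.inv_apply]
  have hps := mul_pos (inv_pos.2 (hpos s)) (hx s)
  have hpt := mul_pos (inv_pos.2 (hpos t)) (hx t)
  rw [← Real.log_le_log_iff hps (by positivity), Real.log_mul (Real.exp_ne_zero _) hpt.ne',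
    Real.log_exp, Real.log_mul (inv_pos.2 (hpos s)).ne' (hx s).ne',
    Real.log_mul (inv_pos.2 (hpos t)).ne' (hx t).ne', Real.log_inv, Real.log_inv, hlog, hlog]
  linarith [hs.1, hs.2, ht.1, ht.2]

omit hn hv in
theorem linearIndependent_embed_integralBasis (hφ : ∀ φ : F →+* ℂ,
    ∃ t, φ = Complex.ofRealHom.comp (v t)) :
    LinearIndependent ℝ fun i => embed v (integralBasis F i) := by
  rw [Fintype.linearIndependent_iff]
  intro g hg
  have h := Fintype.linearIndependent_iff.1 (canonicalEmbedding.latticeBasis F).linearIndependent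
    (fun i => (g i : ℂ)) ?_
  · exact fun i => Complex.ofReal_eq_zero.1 (h i)
  · ext φ
    obtain ⟨t, rfl⟩ := hφ φ
    have h := congrArg (Complex.ofReal) (congrFun hg t)
    simpa [embed, canonicalEmbedding.latticeBasis_apply] using h

end Units

section RationalStructure

theorem IsConstructible.smul_mem {V : Type*} [AddCommGroup V] [Module ℝ V] [Module ℚ V]
    {M : Submodule ℚ V} {S : Set V} (hS : IsConstructible M S) {x : V} (hx : x ∈ S) {t : ℝ}
    (ht : 0 < t) : t • x ∈ S := by
  obtain ⟨L, -, -, h⟩ := hS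
  refine h x _ (fun l _ => ?_) hx
  rw [map_smul, smul_eq_mul, sign_mul, sign_pos ht, one_mul]

theorem IsRationalForm.add {V : Type*} [AddCommGroup V] [Module ℝ V] [Module ℚ V]
    {M : Submodule ℚ V} {l m : V →ₗ[ℝ] ℝ} (hl : IsRationalForm M l) (hm : IsRationalForm M m) :
    IsRationalForm M (l + m) := by
  intro x hx
  obtain ⟨p, hp⟩ := hl x hx
  obtain ⟨q, hq⟩ := hm x hx
  exact ⟨p + q, by simp [hp, hq]⟩

theorem IsRationalForm.smul {V : Type*} [AddCommGroup V] [Module ℝ V] [Module ℚ V]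
    {M : Submodule ℚ V} {l : V →ₗ[ℝ] ℝ} (hl : IsRationalForm M l) (c : ℚ) :
    IsRationalForm M ((c : ℝ) • l) := by
  intro x hx
  obtain ⟨p, hp⟩ := hl x hx
  exact ⟨c * p, by simp [hp]⟩

theorem exists_constructible_nhds {V ι : Type*} [NormedAddCommGroup V] [NormedSpace ℝ V]
    [Module ℚ V] [Fintype ι] {M : Submodule ℚ V} (b : Module.Basis ι ℝ V)
    (hb : ∀ i, IsRationalForm M (b.coord i)) {W : Set V} (hW : IsOpen W)
    (hcone : ∀ x ∈ W, ∀ t : ℝ, 0 < t → t • x ∈ W) {x : V} (hx : x ∈ W) (hx0 : x ≠ 0) :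
    ∃ K ⊆ W, IsConstructible M K ∧ K ∈ nhds x := by
  have hfin : FiniteDimensional ℝ V := Module.Basis.finiteDimensional_of_finite b
  obtain ⟨l, hl, hlx⟩ : ∃ l : V →ₗ[ℝ] ℝ, IsRationalForm M l ∧ 0 < l x := by
    obtain ⟨i, hi⟩ : ∃ i, b.coord i x ≠ 0 := by
      by_contra! h
      exact hx0 (b.forall_coord_eq_zero_iff.1 h)
    rcases lt_or_gt_of_ne hi with h | h
    · refine ⟨((-1 : ℚ) : ℝ) • b.coord i, (hb i).smul _, ?_⟩
      rw [LinearMap.smul_apply, smul_eq_mul]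
      push_cast
      linarith
    · exact ⟨b.coord i, hb i, h⟩
  have hcont : ∀ f : V →ₗ[ℝ] ℝ, Continuous f := fun f => f.continuous_of_finiteDimensional
  let E : V ≃L[ℝ] (ι → ℝ) := b.equivFunL
  have hE : ∀ y i, E y i = b.coord i y := fun y i => rfl
  have hO : IsOpen (E.symm ⁻¹' W) := hW.preimage E.symm.continuous
  have hx' : E ((l x)⁻¹ • x) ∈ E.symm ⁻¹' W := by
    rw [Set.mem_preimage, E.symm_apply_apply]
    exact hcone x hx _ (inv_pos.2 hlx)
  obtain ⟨ε, hε, hball⟩ := Metric.isOpen_iff.1 hO _ hx'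
  choose p hp1 hp2 using fun i => exists_rat_btwn (sub_lt_self (E ((l x)⁻¹ • x) i) hε)
  choose q hq1 hq2 using fun i => exists_rat_btwn (lt_add_of_pos_right (E ((l x)⁻¹ • x) i) hε)
  have hpm : ∀ i y, (b.coord i + ((-p i : ℚ) : ℝ) • l) y = E y i - p i * l y := by
    intro i y
    rw [LinearMap.add_apply, LinearMap.smul_apply, smul_eq_mul, hE]
    push_cast
    ring
  have hqm : ∀ i y, ((q i : ℝ) • l + ((-1 : ℚ) : ℝ) • b.coord i) y = q i * l y - E y i := by
    intro i y
    rw [LinearMap.add_apply, LinearMap.smul_apply, LinearMap.smul_apply, smul_eq_mul, smul_eq_mul,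
      hE]
    push_cast
    ring
  have hEx : ∀ y i, E ((l y)⁻¹ • y) i = E y i / l y := by
    intro y i
    rw [map_smul, Pi.smul_apply, smul_eq_mul, div_eq_inv_mul]
  refine ⟨{y | 0 < l y} ∩ ⋂ i, ({y | 0 < (b.coord i + ((-p i : ℚ) : ℝ) • l) y} ∩
    {y | 0 < ((q i : ℝ) • l + ((-1 : ℚ) : ℝ) • b.coord i) y}), ?_, ?_, ?_⟩
  · rintro y ⟨hly, hy⟩
    have hly : 0 < l y := hly
    have hmem : E ((l y)⁻¹ • y) ∈ Metric.ball (E ((l x)⁻¹ • x)) ε := by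
      rw [Metric.mem_ball, dist_pi_lt_iff hε]
      intro i
      obtain ⟨h1, h2⟩ := Set.mem_iInter.1 hy i
      have h1 : 0 < E y i - p i * l y := (hpm i y) ▸ h1
      have h2 : 0 < q i * l y - E y i := (hqm i y) ▸ h2
      have h3 : (p i : ℝ) < E y i / l y := (lt_div_iff₀ hly).2 (by linarith)
      have h4 : E y i / l y < q i := (div_lt_iff₀ hly).2 (by linarith)
      rw [hEx y, Real.dist_eq, abs_lt]
      constructor
      · linarith [hp1 i]
      · linarith [hq2 i]
    have h := hball hmem
    rw [Set.mem_preimage, E.symm_apply_apply] at h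
    have h2 := hcone _ h _ hly
    rwa [smul_inv_smul₀ hly.ne'] at h2
  · refine (isConstructible_pos hl).inter (IsConstructible.iInter fun i => ?_)
    exact (isConstructible_pos ((hb i).add (hl.smul _))).inter
      (isConstructible_pos ((hl.smul _).add ((hb i).smul _)))
  · refine Filter.inter_mem ?_ (Filter.iInter_mem.2 fun i => Filter.inter_mem ?_ ?_)
    · exact (isOpen_lt continuous_const (hcont l)).mem_nhds hlx
    · refine (isOpen_lt continuous_const (hcont _)).mem_nhds ?_
      have h := hp2 i
      rw [hEx, lt_div_iff₀ hlx] at h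
      change 0 < (b.coord i + ((-p i : ℚ) : ℝ) • l) x
      rw [hpm]
      linarith
    · refine (isOpen_lt continuous_const (hcont _)).mem_nhds ?_
      have h := hq1 i
      rw [hEx, div_lt_iff₀ hlx] at h
      change 0 < ((q i : ℝ) • l + ((-1 : ℚ) : ℝ) • b.coord i) x
      rw [hqm]
      linarith

end RationalStructure

section Orthant

variable {n : ℕ}

/-- The points of the open positive orthant whose coordinate ratios are at most `R`. -/
def ratioCone (n : ℕ) (R : ℝ) : Set (Fin n → ℝ) :=
  {x | (∀ t, 0 < x t) ∧ ∀ s t, x s ≤ R * x t}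

theorem exists_constructible_small_nhds {M : Submodule ℚ (Fin n → ℝ)} {ι : Type*} [Fintype ι]
    (b : Module.Basis ι ℝ (Fin n → ℝ)) (hb : ∀ i, IsRationalForm M (b.coord i)) {c : ℝ} (hc : 1 < c)
    {x : Fin n → ℝ} (hx : ∀ t, 0 < x t) (hx0 : x ≠ 0) :
    ∃ K, IsConstructible M K ∧ K ∈ nhds x ∧ (∀ y ∈ K, ∀ t, 0 < y t) ∧
      ∀ y ∈ K, ∀ z ∈ K, ∀ s t, z s * y t ≤ c * (z t * y s) := by
  have hc' : 1 < Real.sqrt c := by rwa [Real.lt_sqrt zero_le_one, one_pow]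
  let W : Set (Fin n → ℝ) := {y | (∀ t, 0 < y t) ∧ ∀ s t, y s * x t < Real.sqrt c * (y t * x s)}
  have hW : IsOpen W := by
    refine IsOpen.inter (s := {y : Fin n → ℝ | ∀ t, 0 < y t})
      (t := {y | ∀ s t, y s * x t < Real.sqrt c * (y t * x s)}) ?_ ?_
    · simp only [Set.ofPred_forall]
      exact isOpen_iInter_of_finite fun t => isOpen_lt continuous_const (continuous_apply t)
    · simp only [Set.ofPred_forall]
      exact isOpen_iInter_of_finite fun s => isOpen_iInter_of_finite fun t =>
        isOpen_lt (by fun_prop) (by fun_prop)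
  have hcone : ∀ y ∈ W, ∀ t : ℝ, 0 < t → t • y ∈ W := by
    rintro y ⟨hy1, hy2⟩ r hr
    refine ⟨fun t => mul_pos hr (hy1 t), fun s t => ?_⟩
    simp only [Pi.smul_apply, smul_eq_mul]
    have := mul_lt_mul_of_pos_left (hy2 s t) hr
    linarith
  have hxW : x ∈ W := by
    refine ⟨hx, fun s t => ?_⟩
    have := mul_pos (hx s) (hx t)
    nlinarith
  obtain ⟨K, hKW, hK, hKx⟩ := exists_constructible_nhds b hb hW hcone hxW hx0
  refine ⟨K, hK, hKx, fun y hy => (hKW hy).1, fun y hy z hz s t => ?_⟩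
  obtain ⟨hy1, hy2⟩ := hKW hy
  obtain ⟨hz1, hz2⟩ := hKW hz
  have h := mul_lt_mul'' (hz2 s t) (hy2 t s) (mul_pos (hz1 s) (hx t)).le
    (mul_pos (hy1 t) (hx s)).le
  have hsq := Real.mul_self_sqrt (zero_le_one.trans hc.le)
  have hxx := mul_pos (hx s) (hx t)
  refine le_of_mul_le_mul_right ?_ hxx
  calc z s * y t * (x s * x t) = z s * x t * (y t * x s) := by ring
    _ ≤ _ := h.le
    _ = (Real.sqrt c * Real.sqrt c) * (z t * y s) * (x s * x t) := by ring
    _ = _ := by rw [hsq]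

theorem exists_finite_cover (hn : 0 < n) {M : Submodule ℚ (Fin n → ℝ)} {ι : Type*} [Fintype ι]
    (b : Module.Basis ι ℝ (Fin n → ℝ)) (hb : ∀ i, IsRationalForm M (b.coord i)) {c : ℝ} (hc : 1 < c)
    (R : ℝ) : ∃ 𝒦 : Set (Set (Fin n → ℝ)), 𝒦.Finite ∧ ratioCone n R ⊆ ⋃₀ 𝒦 ∧
      ∀ K ∈ 𝒦, IsConstructible M K ∧ K ⊆ ratioCone n (c * R) ∧
        ∀ y ∈ K, ∀ z ∈ K, ∀ s t, z s * y t ≤ c * (z t * y s) := by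
  let Z : Set (Fin n → ℝ) := {x | (∀ t, 0 ≤ x t) ∧ (∀ s t, x s ≤ R * x t) ∧ ∑ t, x t = 1}
  have hZc : IsCompact Z := by
    refine (isCompact_Icc (a := (0 : Fin n → ℝ)) (b := 1)).of_isClosed_subset ?_ ?_
    · refine IsClosed.inter (X := Fin n → ℝ) ?_ (IsClosed.inter (X := Fin n → ℝ) ?_ ?_)
      · have : IsClosed {x : Fin n → ℝ | ∀ t, 0 ≤ x t} := by
          simp only [Set.ofPred_forall]
          exact isClosed_iInter fun t => isClosed_le continuous_const (continuous_apply t)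
        exact this
      · have : IsClosed {x : Fin n → ℝ | ∀ s t, x s ≤ R * x t} := by
          simp only [Set.ofPred_forall]
          exact isClosed_iInter fun s => isClosed_iInter fun t =>
            isClosed_le (by fun_prop) (by fun_prop)
        exact this
      · have : IsClosed {x : Fin n → ℝ | ∑ t, x t = 1} :=
          isClosed_eq (by fun_prop) continuous_const
        exact this
    · rintro x ⟨h1, -, h3⟩
      refine ⟨h1, fun t => ?_⟩
      rw [Pi.one_apply, ← h3]
      exact Finset.single_le_sum (fun s _ => h1 s) (Finset.mem_univ t)
  have hZpos : ∀ x ∈ Z, ∀ t, 0 < x t := by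
    rintro x ⟨h1, h2, h3⟩ t
    refine (h1 t).lt_of_ne' fun h => ?_
    have : ∀ s, x s = 0 := fun s => le_antisymm (by simpa [h] using h2 s t) (h1 s)
    simp [this] at h3
  have hZne : ∀ x ∈ Z, x ≠ 0 := fun x hx h => by
    have := hZpos x hx ⟨0, hn⟩
    simp [h] at this
  choose! K hK hKx hKpos hKs using fun x (hx : x ∈ Z) =>
    exists_constructible_small_nhds b hb hc (hZpos x hx) (hZne x hx)
  obtain ⟨T, hTZ, hT⟩ := hZc.elim_nhds_subcover K hKx
  refine ⟨K '' T, T.finite_toSet.image K, fun x hx => ?_, ?_⟩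
  · have hsum : 0 < ∑ t, x t := Finset.sum_pos (fun t _ => hx.1 t) ⟨⟨0, hn⟩, Finset.mem_univ _⟩
    have hxZ : (∑ t, x t)⁻¹ • x ∈ Z := by
      refine ⟨fun t => (mul_pos (inv_pos.2 hsum) (hx.1 t)).le, fun s t => ?_, ?_⟩
      · simp only [Pi.smul_apply, smul_eq_mul]
        have := mul_le_mul_of_nonneg_left (hx.2 s t) (inv_pos.2 hsum).le
        linarith
      · simp only [Pi.smul_apply, smul_eq_mul, ← Finset.mul_sum]
        exact inv_mul_cancel₀ hsum.ne'
    obtain ⟨y, hy, hxy⟩ := Set.mem_iUnion₂.1 (hT hxZ)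
    refine ⟨K y, ⟨y, hy, rfl⟩, ?_⟩
    have := (hK y (hTZ y hy)).smul_mem hxy hsum
    rwa [smul_inv_smul₀ hsum.ne'] at this
  · rintro _ ⟨x, hx, rfl⟩
    have hxZ := hTZ x hx
    refine ⟨hK x hxZ, fun y hy => ⟨hKpos x hxZ y hy, fun s t => ?_⟩, hKs x hxZ⟩
    have hxK : x ∈ K x := mem_of_mem_nhds (hKx x hxZ)
    have h1 := hKs x hxZ x hxK y hy s t
    have hyt := hKpos x hxZ y hy t
    have hxt := hZpos x hxZ t
    have h2 := hxZ.2.1 s t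
    refine le_of_mul_le_mul_right ?_ hxt
    have h3 : c * (y t * x s) ≤ c * (y t * (R * x t)) := by gcongr
    linarith

/-- A constructible fundamental domain for a group `U` of positive vectors acting on the orthant,
on the union of finitely many constructible sets on which `U` acts without identifications. -/
theorem exists_constructible_fundamentalDomain {M : Submodule ℚ (Fin n → ℝ)}
    {U : Set (Fin n → ℝ)} (hU1 : 1 ∈ U) (hUinv : ∀ e ∈ U, e⁻¹ ∈ U) (hUpos : ∀ e ∈ U, ∀ t, 0 < e t)
    (hUM : ∀ e ∈ U, ∀ x ∈ M, e * x ∈ M) {B : Set (Fin n → ℝ)}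
    (hB : {e ∈ U | ∃ y ∈ B, e * y ∈ B}.Finite)
    {𝒦 : Set (Set (Fin n → ℝ))} (h𝒦 : 𝒦.Finite) (hc : ∀ K ∈ 𝒦, IsConstructible M K)
    (hKB : ∀ K ∈ 𝒦, K ⊆ B) (hsmall : ∀ K ∈ 𝒦, ∀ e ∈ U, ∀ y ∈ K, e * y ∈ K → e = 1) :
    ∃ D ⊆ B, IsConstructible M D ∧ (∀ e ∈ U, ∀ y ∈ D, e * y ∈ D → e = 1) ∧
      ∀ K ∈ 𝒦, ∀ x ∈ K, ∃ e ∈ U, ∃ y ∈ D, x = e * y := by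
  have hcancel : ∀ e ∈ U, ∀ y : Fin n → ℝ, e⁻¹ * (e * y) = y := fun e he y => by
    ext t
    simp [(hUpos e he t).ne']
  have hcancel' : ∀ e ∈ U, ∀ y : Fin n → ℝ, e * (e⁻¹ * y) = y := fun e he y => by
    ext t
    simp [(hUpos e he t).ne']
  induction 𝒦, h𝒦 using Set.Finite.induction_on with
  | empty => exact ⟨∅, by simp, IsConstructible.empty M, by simp, by simp⟩
  | @insert K 𝒦 _ _ ih =>
    obtain ⟨D, hDB, hD, hinj, hcov⟩ := ih (fun K' h => hc K' (Or.inr h))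
      (fun K' h => hKB K' (Or.inr h)) (fun K' h => hsmall K' (Or.inr h))
    have hKc := hc K (Or.inl rfl)
    have hKB := hKB K (Or.inl rfl)
    have hKs := hsmall K (Or.inl rfl)
    let G : Set (Fin n → ℝ) := {e ∈ U | ∃ y ∈ B, e * y ∈ B}
    have hGfin : Finite G := hB
    let N : Set (Fin n → ℝ) := K ∩ ⋂ e : G, ((LinearMap.mulLeft ℝ (e : Fin n → ℝ)) ⁻¹' D)ᶜ
    have hNmem : ∀ x, x ∈ N ↔ x ∈ K ∧ ∀ e ∈ G, e * x ∉ D := by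
      intro x
      simp only [N, Set.mem_inter_iff, Set.mem_iInter, Set.mem_compl_iff, Set.mem_preimage,
        LinearMap.mulLeft_apply, Subtype.forall]
    refine ⟨D ∪ N, Set.union_subset hDB (Set.inter_subset_left.trans hKB), hD.union
      (hKc.inter (IsConstructible.iInter fun e => (hD.preimage _ (hUM e e.2.1)).compl)), ?_, ?_⟩
    · rintro e he y (hy | hy) (hey | hey)
      · exact hinj e he y hy hey
      · obtain ⟨h1, h2⟩ := (hNmem _).1 hey
        refine absurd ?_ (h2 e⁻¹ ⟨hUinv e he, _, hKB h1, ?_⟩) <;> rw [hcancel e he]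
        exacts [hy, hDB hy]
      · obtain ⟨h1, h2⟩ := (hNmem _).1 hy
        exact absurd hey (h2 e ⟨he, _, hKB h1, hDB hey⟩)
      · exact hKs e he y ((hNmem _).1 hy).1 ((hNmem _).1 hey).1
    · rintro K' (rfl | hK') x hx
      · by_cases h : ∃ e ∈ G, e * x ∈ D
        · obtain ⟨e, he, hex⟩ := h
          refine ⟨e⁻¹, hUinv e he.1, _, Or.inl hex, (hcancel e he.1 x).symm⟩
        · push Not at h
          exact ⟨1, hU1, x, Or.inr ((hNmem x).2 ⟨hx, h⟩), (one_mul x).symm⟩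
      · obtain ⟨e, he, y, hy, rfl⟩ := hcov K' hK' x hx
        exact ⟨e, he, y, Or.inl hy, rfl⟩

theorem nonneg_of_openCone_subset {r : ℕ} {w : Fin r → Fin n → ℝ}
    (h : ∀ x ∈ openCone w, ∀ t, 0 < x t) (i : Fin r) (t : Fin n) : 0 ≤ w i t := by
  by_contra! hneg
  have h1 := h (∑ j, (1 : ℝ) • w j) ⟨fun _ => 1, by simp, rfl⟩ t
  set N := (∑ j, (1 : ℝ) • w j) t / -w i t with hN
  have hNpos : 0 < N := div_pos h1 (neg_pos.2 hneg)
  have h2 := h (∑ j, (1 + Pi.single (M := fun _ => ℝ) i N j) • w j)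
    ⟨fun j => 1 + Pi.single (M := fun _ => ℝ) i N j, fun j => by
      have : (0 : ℝ) ≤ Pi.single (M := fun _ => ℝ) i N j := by
        rw [Pi.single_apply]; split_ifs <;> [exact hNpos.le; exact le_rfl]
      linarith, rfl⟩ t
  simp only [add_smul, Finset.sum_add_distrib, Pi.add_apply] at h2
  have h3 : (∑ j, Pi.single (M := fun _ => ℝ) i N j • w j) t = N * w i t := by
    have hs : ∑ j, Pi.single (M := fun _ => ℝ) i N j • w j = N • w i := by
      simp only [Pi.single_apply, ite_smul, zero_smul, Finset.sum_ite_eq', Finset.mem_univ, if_true]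
    rw [hs]; rfl
  have h4 : N * w i t = -(∑ j, (1 : ℝ) • w j) t := by
    rw [hN, div_neg, neg_mul, div_mul_cancel₀ _ hneg.ne]
  rw [h3, h4] at h2
  linarith

end Orthant

section NumberField

variable {F : Type*} [Field F] {n : ℕ} (v : Fin n → (F →+* ℝ))

/-- The rational structure on `ℝⁿ` given by the image of the number field. -/
noncomputable def embedRange [CharZero F] : Submodule ℚ (Fin n → ℝ) :=
  LinearMap.range (RingHom.pi v).toRatAlgHom.toLinearMap

theorem mem_embedRange [CharZero F] {x : Fin n → ℝ} :
    x ∈ embedRange v ↔ ∃ a : F, x = fun t => v t a := by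
  constructor
  · rintro ⟨a, rfl⟩
    exact ⟨a, rfl⟩
  · rintro ⟨a, rfl⟩
    exact ⟨a, rfl⟩

variable [NumberField F] (hn : n = Module.finrank ℚ F) (hv : Function.Bijective v)

include hn hv

theorem exists_basis_rational_coord : ∃ b : Module.Basis (Fin n) ℝ (Fin n → ℝ),
    (∀ i, b i ∈ embedRange v) ∧ ∀ i, IsRationalForm (embedRange v) (b.coord i) := by
  have hcard : Fintype.card (Module.Free.ChooseBasisIndex ℤ (𝓞 F)) = n := by
    rw [hn, Module.finrank_eq_card_basis (integralBasis F)]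
  have : Nonempty (Fin n) := Fin.pos_iff_nonempty.1 (hn ▸ Module.finrank_pos)
  let ε := Fintype.equivFinOfCardEq hcard
  let a := (integralBasis F).reindex ε
  have hli : LinearIndependent ℝ fun i => embed v (a i) := by
    have h := (linearIndependent_embed_integralBasis v
      (exists_complex_embedding_eq v hn hv)).comp ε.symm ε.symm.injective
    convert h using 2 with i
    simp [a]
  let b := basisOfLinearIndependentOfCardEqFinrank hli (by simp)
  have hb : ∀ i, b i = embed v (a i) := fun i => by simp [b]
  refine ⟨b, fun i => (mem_embedRange v).2 ⟨_, hb i⟩, fun i x hx => ?_⟩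
  obtain ⟨y, rfl⟩ := (mem_embedRange v).1 hx
  refine ⟨a.repr y i, ?_⟩
  have : (fun t => v t y) = ∑ j, (a.repr y j : ℝ) • b j := by
    ext t
    conv_lhs => rw [← a.sum_repr y]
    simp only [map_sum, Rat.smul_def, map_mul, map_ratCast, Finset.sum_apply, Pi.smul_apply, hb,
      embed, smul_eq_mul]
  rw [this, Module.Basis.coord_apply, b.repr_sum_self]

theorem exists_one_lt_of_ne_one {e : Fin n → ℝ} (he : e ∈ unitSquares v) (hne : e ≠ 1) :
    ∃ t, 1 < e t := by
  by_contra! h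
  have hpos := unitSquares_pos v he
  have hlog : ∀ t ∈ Finset.univ, Real.log (e t) ≤ 0 := fun t _ =>
    Real.log_nonpos (hpos t).le (h t)
  have h0 := (Finset.sum_eq_zero_iff_of_nonpos hlog).1 (sum_log_unitSquares v hn hv he)
  exact hne (funext fun t => Real.eq_one_of_pos_of_log_eq_zero (hpos t) (h0 t (Finset.mem_univ t)))

theorem exists_le_one {e : Fin n → ℝ} (he : e ∈ unitSquares v) : ∃ t, e t ≤ 1 := by
  by_contra! h
  have hpos : 0 < n := hn ▸ Module.finrank_pos
  have := Finset.sum_pos (fun t _ => Real.log_pos (h t))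
    (⟨⟨0, hpos⟩, Finset.mem_univ _⟩ : (Finset.univ : Finset (Fin n)).Nonempty)
  rw [sum_log_unitSquares v hn hv he] at this
  exact lt_irrefl _ this

theorem exists_eq_one_of_le :
    ∃ c : ℝ, 1 < c ∧ ∀ e ∈ unitSquares v, (∀ t, e t ≤ c) → e = 1 := by
  have hfin : {e ∈ unitSquares v | (∀ t, e t ≤ 2) ∧ e ≠ 1}.Finite :=
    (finite_unitSquares_le v hn hv 2).subset fun e he => ⟨he.1, he.2.1⟩
  have h1 : ∀ᶠ c in nhdsWithin (1 : ℝ) (Set.Ioi 1),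
      ∀ e ∈ {e ∈ unitSquares v | (∀ t, e t ≤ 2) ∧ e ≠ 1}, ∃ t, c < e t := by
    rw [Filter.eventually_all_finite hfin]
    rintro e ⟨he, -, hne⟩
    obtain ⟨t, ht⟩ := exists_one_lt_of_ne_one v hn hv he hne
    filter_upwards [mem_nhdsWithin_of_mem_nhds (Iio_mem_nhds ht)] with c hc
    exact ⟨t, hc⟩
  have h2 : ∀ᶠ c in nhdsWithin (1 : ℝ) (Set.Ioi 1), c < 2 :=
    mem_nhdsWithin_of_mem_nhds (Iio_mem_nhds one_lt_two)
  obtain ⟨c, ⟨hc1, hc2⟩, hc3⟩ := ((h1.and h2).and self_mem_nhdsWithin).exists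
  refine ⟨c, hc3, fun e he hec => ?_⟩
  by_contra hne
  obtain ⟨t, ht⟩ := hc1 e ⟨he, fun t => (hec t).trans hc2.le, hne⟩
  exact absurd (hec t) (not_le.2 ht)

theorem finite_unitSquares_ratioCone (R : ℝ) :
    {e ∈ unitSquares v | ∃ y ∈ ratioCone n R, e * y ∈ ratioCone n R}.Finite := by
  refine (finite_unitSquares_le v hn hv (R * R)).subset ?_
  rintro e ⟨he, y, ⟨hy1, hy2⟩, -, hey⟩
  refine ⟨he, fun s => ?_⟩
  obtain ⟨t, ht⟩ := exists_le_one v hn hv he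
  have hR : 0 ≤ R := by
    have h := hy2 s s
    have hs := hy1 s
    by_contra! hneg
    nlinarith
  have hpos := unitSquares_pos v he
  have h1 : e s * y s ≤ R * (e t * y t) := hey s t
  have h2 := hy2 t s
  refine le_of_mul_le_mul_right ?_ (hy1 s)
  calc e s * y s ≤ R * (e t * y t) := h1
    _ ≤ R * (1 * (R * y s)) := by
        have := hpos t
        have := hy1 t
        gcongr
    _ = R * R * y s := by ring

theorem exists_triangulable_fundamentalDomain :
    ∃ D : Set (Fin n → ℝ), Triangulable (embedRange v) D ∧ (∀ x ∈ D, ∀ t, 0 < x t) ∧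
      (∀ e ∈ unitSquares v, ∀ y ∈ D, e * y ∈ D → e = 1) ∧
      ∀ x : Fin n → ℝ, (∀ t, 0 < x t) → ∃ e ∈ unitSquares v, ∃ y ∈ D, x = e * y := by
  obtain ⟨b, hbM, hb⟩ := exists_basis_rational_coord v hn hv
  obtain ⟨R, hR⟩ := exists_unitSquares_ratio_le v hn hv
  obtain ⟨c, hc, hc1⟩ := exists_eq_one_of_le v hn hv
  have hpos : 0 < n := hn ▸ Module.finrank_pos
  obtain ⟨𝒦, h𝒦, hcov, hK⟩ := exists_finite_cover hpos b hb hc R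
  have hUM : ∀ e ∈ unitSquares v, ∀ x ∈ embedRange v, e * x ∈ embedRange v := by
    rintro e ⟨u, rfl⟩ x hx
    obtain ⟨a, rfl⟩ := (mem_embedRange v).1 hx
    exact (mem_embedRange v).2 ⟨(((u ^ 2 : (𝓞 F)ˣ) : 𝓞 F) : F) * a, by ext t; simp⟩
  have hsmall : ∀ K ∈ 𝒦, ∀ e ∈ unitSquares v, ∀ y ∈ K, e * y ∈ K → e = 1 := by
    intro K hK𝒦 e he y hy hey
    obtain ⟨-, hKR, hKs⟩ := hK K hK𝒦
    obtain ⟨t, ht⟩ := exists_le_one v hn hv he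
    refine hc1 e he fun s => ?_
    have h : e s * y s * y t ≤ c * (e t * y t * y s) := hKs y hy _ hey s t
    have hyy := mul_pos ((hKR hy).1 s) ((hKR hy).1 t)
    have h2 : e s ≤ c * e t := le_of_mul_le_mul_right (by linarith) hyy
    nlinarith
  obtain ⟨D, hDB, hD, hinj, hcovD⟩ := exists_constructible_fundamentalDomain
    (one_mem_unitSquares v) (fun e he => inv_mem_unitSquares v he)
    (fun e he => unitSquares_pos v he) hUM (finite_unitSquares_ratioCone v hn hv (c * R)) h𝒦
    (fun K h => (hK K h).1) (fun K h => (hK K h).2.1) hsmall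
  refine ⟨D, ?_, fun x hx => (hDB hx).1, hinj, fun x hx => ?_⟩
  · refine hD.triangulable ?_ (Set.range b.coord) (Set.finite_range _) ?_ ?_
    · rw [eq_top_iff, ← b.span_eq]
      exact Submodule.span_mono (Set.range_subset_iff.2 hbM)
    · rintro _ ⟨i, rfl⟩
      exact hb i
    · exact fun x hx => b.forall_coord_eq_zero_iff.1 fun i => hx _ ⟨i, rfl⟩
  · obtain ⟨e, he, heR⟩ := hR x hx
    have hepos := unitSquares_pos v he
    have hmem : e⁻¹ * x ∈ ratioCone n R :=
      ⟨fun t => mul_pos (inv_pos.2 (hepos t)) (hx t), heR⟩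
    obtain ⟨K, hK𝒦, hxK⟩ := hcov hmem
    obtain ⟨f, hf, y, hy, hxy⟩ := hcovD K hK𝒦 _ hxK
    refine ⟨e * f, mul_mem_unitSquares v he hf, y, hy, ?_⟩
    rw [mul_assoc, ← hxy]
    ext t
    simp [(hepos t).ne']

end NumberField

end Shintani

/-- Shintani's theorem (Theorem 3.3): let `F` be a totally real number field of degree
`n`, with the `n` real embeddings `v 0, …, v (n-1)`, and let the squares of units act on
`ℝⁿ_{>0}` by componentwise multiplication. Then there are finitely many tuples of linearly
independent vectors in `v(F) ∩ ℝⁿ_{≥0}` whose open simplicial cones are pairwise disjoint,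
contained in `ℝⁿ_{>0}`, and whose union `Δ` is a fundamental domain: every `x ∈ ℝⁿ_{>0}`
lies in `u·Δ` for exactly one vector `u` in the image of `ℤ_F^{×2}`. -/
theorem shintani_theorem (F : Type*) [Field F] [NumberField F]
    (n : ℕ) (hn : n = Module.finrank ℚ F)
    (v : Fin n → (F →+* ℝ)) (hv : Function.Bijective v) :
    ∃ (m : ℕ) (r : Fin m → ℕ) (w : (j : Fin m) → Fin (r j) → (Fin n → ℝ)),
      (∀ j, LinearIndependent ℝ (w j)) ∧
      (∀ j i, (∃ a : F, w j i = fun t => v t a) ∧ (∀ t, 0 ≤ w j i t)) ∧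
      (∀ j, {x : Fin n → ℝ | ∃ lam : Fin (r j) → ℝ, (∀ i, 0 < lam i) ∧
              x = ∑ i, lam i • w j i} ⊆ {x : Fin n → ℝ | ∀ t, 0 < x t}) ∧
      (∀ j j', j ≠ j' → Disjoint
        {x : Fin n → ℝ | ∃ lam : Fin (r j) → ℝ, (∀ i, 0 < lam i) ∧ x = ∑ i, lam i • w j i}
        {x : Fin n → ℝ | ∃ lam : Fin (r j') → ℝ, (∀ i, 0 < lam i) ∧ x = ∑ i, lam i • w j' i}) ∧
      (∀ x : Fin n → ℝ, (∀ t, 0 < x t) →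
        ∃! e : Fin n → ℝ,
          (∃ u : (𝓞 F)ˣ, e = fun t => v t (((u ^ 2 : (𝓞 F)ˣ) : 𝓞 F) : F)) ∧
          ∃ y ∈ ⋃ j, {x : Fin n → ℝ | ∃ lam : Fin (r j) → ℝ, (∀ i, 0 < lam i) ∧
                x = ∑ i, lam i • w j i},
            x = fun t => e t * y t) := by
  obtain ⟨D, ⟨T, hTf, hTd, hTs, rfl⟩, hpos, hinj, hcov⟩ :=
    Shintani.exists_triangulable_fundamentalDomain v hn hv
  have : Finite T := hTf
  let φ := (Finite.equivFin T).symm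
  choose r w hw hwM hC using fun j => hTs (φ j) (φ j).2
  have hsub : ∀ j, Shintani.openCone (w j) ⊆ ⋃₀ T := fun j =>
    hC j ▸ Set.subset_sUnion_of_mem (φ j).2
  refine ⟨_, r, w, hw, fun j i => ⟨(Shintani.mem_embedRange v).1 (hwM j i),
    Shintani.nonneg_of_openCone_subset (fun x hx => hpos x (hsub j hx)) i⟩,
    fun j x hx => hpos x (hsub j hx), fun j j' hjj' => ?_, fun x hx => ?_⟩
  · change Disjoint (Shintani.openCone (w j)) (Shintani.openCone (w j'))
    rw [← hC, ← hC]
    exact hTd (φ j).2 (φ j').2 fun h => hjj' (φ.injective (Subtype.ext h))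
  · have hD : ⋃₀ T = ⋃ j, Shintani.openCone (w j) := by
      rw [Set.sUnion_eq_iUnion, ← φ.surjective.iUnion_comp]
      exact Set.iUnion_congr hC
    obtain ⟨e, he, y, hy, hxy⟩ := hcov x hx
    refine ⟨e, ⟨he, y, hD ▸ hy, hxy⟩, ?_⟩
    rintro f ⟨hf, z, hz, hxz⟩
    have hz : z ∈ ⋃₀ T := hD ▸ hz
    have hf0 := Shintani.unitSquares_pos v hf
    have hzy : f⁻¹ * e * y = z := by
      ext t
      have h := congrFun (hxy.symm.trans hxz) t
      simp only [Pi.mul_apply] at h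
      simp only [Pi.mul_apply, Pi.inv_apply, mul_assoc, h]
      rw [inv_mul_cancel_left₀ (hf0 t).ne']
    have h1 := hinj _ (Shintani.mul_mem_unitSquares v (Shintani.inv_mem_unitSquares v hf) he) y hy
      (hzy.symm ▸ hz)
    ext t
    have h2 := congrFun h1 t
    simp only [Pi.mul_apply, Pi.inv_apply, Pi.one_apply] at h2
    rw [inv_mul_eq_one₀ (hf0 t).ne'] at h2
    exact h2
end
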